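/- Let n ≥ 2 and let f : ℝ → ℝ satisfy: (1) f is strictly decreasing (x₁ > x₂ implies f(x₁) < f(x₂)); (2) f is convex; (3) f is positive; (4) α − γ₀ > n·f(0); and (5) f(k₁+1) − f(k₁) − n·(f(k₂+1) − f(k₂)) > 0 for all k₁, k₂ ∈ {0, 1, …, n−1}. Then the complete graph g^c on {1,…,n} is pairwise stable for the profits Y_i; in fact, for every link ij of g^c, Y_i(g^c − ij) < Y_i(g^c) and Y_j(g^c − ij) < Y_j(g^c). -/

import Mathlib

open Finset

/-- The degree of vertex `i` in the simple graph `g`. -/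
noncomputable def deg {n : ℕ} (g : SimpleGraph (Fin n)) (i : Fin n) : ℕ :=
  Nat.card (g.neighborSet i)

/-- The graph obtained from `g` by deleting the link `ij`. -/
def delLink {n : ℕ} (g : SimpleGraph (Fin n)) (i j : Fin n) : SimpleGraph (Fin n) :=
  g.deleteEdges {s(i, j)}

/-- The graph obtained from `g` by adding the link `ij`. -/
def addLink {n : ℕ} (g : SimpleGraph (Fin n)) (i j : Fin n) : SimpleGraph (Fin n) :=
  g ⊔ SimpleGraph.fromEdgeSet {s(i, j)}

/-- Pairwise stability of a graph `g` with respect to payoffs `Y`. -/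
def PairwiseStable {n : ℕ} (Y : Fin n → SimpleGraph (Fin n) → ℝ)
    (g : SimpleGraph (Fin n)) : Prop :=
  (∀ i j, g.Adj i j → Y i (delLink g i j) ≤ Y i g ∧ Y j (delLink g i j) ≤ Y j g) ∧
  (∀ i j, i ≠ j → ¬ g.Adj i j → (Y i g < Y i (addLink g i j) → Y j (addLink g i j) < Y j g))

theorem deg_top {n : ℕ} (i : Fin n) : deg (⊤ : SimpleGraph (Fin n)) i = n - 1 := by
  have h : (⊤ : SimpleGraph (Fin n)).neighborSet i = ((univ.erase i : Finset (Fin n)) : Set _) := by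
    ext k
    simp [eq_comm]
  rw [deg, h, Nat.card_coe_set_eq, Set.ncard_coe_finset, card_erase_of_mem (mem_univ i), card_univ,
    Fintype.card_fin]

theorem delLink_comm {n : ℕ} (g : SimpleGraph (Fin n)) (i j : Fin n) :
    delLink g i j = delLink g j i := by
  rw [delLink, delLink, Sym2.eq_swap]

theorem deg_delLink_top_left {n : ℕ} {i j : Fin n} (hij : i ≠ j) :
    deg (delLink (⊤ : SimpleGraph (Fin n)) i j) i = n - 2 := by
  have h : (delLink (⊤ : SimpleGraph (Fin n)) i j).neighborSet i =
      (((univ.erase i).erase j : Finset (Fin n)) : Set _) := by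
    ext k
    simp only [delLink, SimpleGraph.mem_neighborSet, SimpleGraph.deleteEdges_adj,
      SimpleGraph.top_adj, Set.mem_singleton_iff, Sym2.eq_iff, coe_erase, coe_univ, Set.mem_sdiff,
      Set.mem_univ, true_and]
    grind
  rw [deg, h, Nat.card_coe_set_eq, Set.ncard_coe_finset,
    card_erase_of_mem (mem_erase.2 ⟨hij.symm, mem_univ j⟩), card_erase_of_mem (mem_univ i),
    card_univ, Fintype.card_fin]
  rfl

theorem deg_delLink_of_ne {n : ℕ} (g : SimpleGraph (Fin n)) {i j k : Fin n} (hi : k ≠ i)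
    (hj : k ≠ j) : deg (delLink g i j) k = deg g k := by
  have h : (delLink g i j).neighborSet k = g.neighborSet k := by
    ext l
    simp only [delLink, SimpleGraph.mem_neighborSet, SimpleGraph.deleteEdges_adj,
      Set.mem_singleton_iff, Sym2.eq_iff]
    grind
  rw [deg, deg, h]

/-- In Cournot equilibrium the price-cost margin of a firm equals its quantity. -/
theorem cournot_margin_eq {n : ℕ} (α γ₀ : ℝ) (x q : Fin n → ℝ)
    (hq : ∀ i, q i = (α - γ₀ - n * x i + ∑ j ∈ univ.erase i, x j) / (n + 1)) (i : Fin n) :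
    α - ∑ j, q j - (γ₀ + x i) = q i := by
  have hn : (n : ℝ) + 1 ≠ 0 := by positivity
  have hq' : ∀ k, q k = (α - γ₀ + ∑ j, x j) / (n + 1) - x k := fun k => by
    rw [hq, ← add_sum_erase univ x (mem_univ k)]
    field_simp
    ring
  have hsum : ∑ k, q k = n * ((α - γ₀ + ∑ j, x j) / (n + 1)) - ∑ j, x j := by
    simp only [hq', sum_sub_distrib, sum_const, card_univ, Fintype.card_fin, nsmul_eq_mul]
  rw [hsum, hq']
  field_simp
  ring

theorem stmt_12 (n : ℕ) (hn : 2 ≤ n) (α γ₀ : ℝ) (f : ℝ → ℝ)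
    (hdec : ∀ x₁ x₂ : ℝ, x₂ < x₁ → f x₁ < f x₂)
    (hconv : ConvexOn ℝ Set.univ f)
    (hpos : ∀ x : ℝ, 0 < f x)
    (hparam : α - γ₀ > n * f 0)
    (hsteep : ∀ k₁ k₂ : ℕ, k₁ ≤ n - 1 → k₂ ≤ n - 1 →
      (f ((k₁ : ℝ) + 1) - f (k₁ : ℝ)) - n * (f ((k₂ : ℝ) + 1) - f (k₂ : ℝ)) > 0)
    (q : SimpleGraph (Fin n) → Fin n → ℝ)
    (hq : ∀ g i, q g i = (α - γ₀ - n * f (deg g i : ℝ)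
      + ∑ j ∈ univ.erase i, f (deg g j : ℝ)) / (n + 1))
    (P : SimpleGraph (Fin n) → ℝ) (hP : ∀ g, P g = α - ∑ j, q g j)
    (c : SimpleGraph (Fin n) → Fin n → ℝ)
    (hc : ∀ g i, c g i = γ₀ + f (deg g i : ℝ))
    (Y : Fin n → SimpleGraph (Fin n) → ℝ)
    (hY : ∀ i g, Y i g = q g i * (P g - c g i)) :
    PairwiseStable Y (⊤ : SimpleGraph (Fin n)) ∧
    ∀ i j : Fin n, i ≠ j →
      Y i (delLink (⊤ : SimpleGraph (Fin n)) i j) < Y i (⊤ : SimpleGraph (Fin n)) ∧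
      Y j (delLink (⊤ : SimpleGraph (Fin n)) i j) < Y j (⊤ : SimpleGraph (Fin n)) := by
  have key : ∀ i j : Fin n, i ≠ j →
      Y i (delLink (⊤ : SimpleGraph (Fin n)) i j) < Y i (⊤ : SimpleGraph (Fin n)) := by
    intro i j hij
    have hYq : ∀ g, Y i g = q g i ^ 2 := fun g => by
      rw [hY, hP, hc, cournot_margin_eq α γ₀ (fun k => f (deg g k)) (q g) (hq g) i, sq]
    have hqpos : ∀ g, 0 < q g i := fun g => by
      have hle : f (deg g i) ≤ f 0 := by
        rcases (Nat.cast_nonneg (α := ℝ) (deg g i)).eq_or_lt with h | h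
        · rw [← h]
        · exact (hdec _ _ h).le
      have hmul : n * f (deg g i) ≤ n * f 0 := by gcongr
      have hsum : 0 ≤ ∑ j ∈ univ.erase i, f (deg g j) := sum_nonneg fun k _ => (hpos _).le
      rw [hq]
      exact div_pos (by linarith) (by positivity)
    have hj : j ∈ univ.erase i := mem_erase.2 ⟨hij.symm, mem_univ j⟩
    have hrest : ∑ k ∈ (univ.erase i).erase j, f (deg (delLink ⊤ i j) k) =
        ∑ k ∈ (univ.erase i).erase j, f (deg (⊤ : SimpleGraph (Fin n)) k) := by
      refine sum_congr rfl fun k hk => ?_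
      simp only [mem_erase] at hk
      rw [deg_delLink_of_ne _ hk.2.1 hk.1]
    have hlt : f ((n - 1 : ℕ) : ℝ) < f ((n - 2 : ℕ) : ℝ) :=
      hdec _ _ (Nat.cast_lt.2 (by omega))
    have hn' : (2 : ℝ) ≤ n := by exact_mod_cast hn
    rw [hYq, hYq]
    refine pow_lt_pow_left₀ ?_ (hqpos _).le two_ne_zero
    rw [hq, hq, ← add_sum_erase _ _ hj, ← add_sum_erase _ _ hj, hrest, deg_delLink_top_left hij,
      delLink_comm, deg_delLink_top_left hij.symm, deg_top, deg_top]
    refine div_lt_div_of_pos_right ?_ (by positivity)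
    nlinarith
  have key' : ∀ i j : Fin n, i ≠ j →
      Y j (delLink (⊤ : SimpleGraph (Fin n)) i j) < Y j (⊤ : SimpleGraph (Fin n)) :=
    fun i j hij => delLink_comm ⊤ i j ▸ key j i hij.symm
  exact ⟨⟨fun i j h => ⟨(key i j h.ne).le, (key' i j h.ne).le⟩, fun i j hij h => (h hij).elim⟩,
    fun i j hij => ⟨key i j hij, key' i j hij⟩⟩
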